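/- Let G be a continuous cumulative distribution function on ℝ with density g, hazard function h = g/(1−G), and let X have survival function (1−G(x))^{1/θ} for a parameter θ > 0. Let u be a measurable function with E[|u(X)|] < ∞ and ∫_{−∞}^x u(t) h(t) dt finite for all x. Define ν(x) = ∫_{−∞}^x u(t) h(t) dt. Then E[ν(X)] = θ · E[u(X)]. -/

import Mathlib

open MeasureTheory Real

lemma ac_comp_lip {φ G : ℝ → ℝ} {a b : ℝ} {K : NNReal} {s : Set ℝ}
    (hφ : LipschitzOnWith K φ s) (hs : ∀ x ∈ Set.uIcc a b, G x ∈ s)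
    (hG : AbsolutelyContinuousOnInterval G a b) :
    AbsolutelyContinuousOnInterval (fun x => φ (G x)) a b := by
  rw [absolutelyContinuousOnInterval_iff] at hG ⊢
  intro ε hε
  obtain ⟨δ, hδ, H⟩ := hG (ε / (K + 1)) (by positivity)
  refine ⟨δ, hδ, fun E hE hE2 => ?_⟩
  have h1 := H E hE hE2
  calc
    _ ≤ ∑ i ∈ Finset.range E.1, K * dist (G (E.2 i).1) (G (E.2 i).2) := by
      apply Finset.sum_le_sum
      intro i hi
      exact hφ.dist_le_mul _ (hs _ (hE.left i hi).left) _ (hs _ (hE.left i hi).right)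
    _ = K * ∑ i ∈ Finset.range E.1, dist (G (E.2 i).1) (G (E.2 i).2) := by
      symm; exact Finset.mul_sum _ _ _
    _ ≤ K * (ε / (K + 1)) := by gcongr
    _ < (K + 1) * (ε / (K + 1)) := by gcongr; linarith
    _ = ε := by field

/-- Basic facts about `G`. -/
lemma phr_integrable
    (θ : ℝ) (G g : ℝ → ℝ)
    (hGg : ∀ x : ℝ, G x = ∫ t in Set.Iic x, g t)
    (μ : Measure ℝ) [IsProbabilityMeasure μ]
    (hsurv : ∀ x : ℝ, μ (Set.Ioi x) = ENNReal.ofReal ((1 - G x) ^ (1 / θ))) (x : ℝ) :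
    IntegrableOn g (Set.Iic x) := by
  by_contra hx
  have h1 : ∀ y, x ≤ y → μ (Set.Ioi y) = 1 := by
    intro y hy
    have : ¬ IntegrableOn g (Set.Iic y) := fun h => hx (h.mono_set (Set.Iic_subset_Iic.2 hy))
    rw [hsurv, hGg, integral_undef this]
    simp
  have h2 : Filter.Tendsto (fun n : ℕ => μ (Set.Ioi (n : ℝ))) Filter.atTop
      (nhds (μ (⋂ n : ℕ, Set.Ioi (n : ℝ)))) := by
    apply tendsto_measure_iInter_atTop
    · intro i; exact measurableSet_Ioi.nullMeasurableSet
    · intro i j hij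
      exact Set.Ioi_subset_Ioi (by exact_mod_cast hij)
    · exact ⟨0, measure_ne_top _ _⟩
  have h3 : (⋂ n : ℕ, Set.Ioi (n : ℝ)) = ∅ := by
    ext y
    simp only [Set.mem_iInter, Set.mem_Ioi, Set.mem_empty_iff_false, iff_false, not_forall, not_lt]
    exact exists_nat_ge y
  rw [h3, measure_empty] at h2
  have h4 : Filter.Tendsto (fun n : ℕ => μ (Set.Ioi (n : ℝ))) Filter.atTop (nhds 1) := by
    apply tendsto_const_nhds.congr'
    obtain ⟨N, hN⟩ := exists_nat_ge x
    filter_upwards [Filter.eventually_ge_atTop N] with n hn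
    exact (h1 n (hN.trans (by exact_mod_cast hn))).symm
  exact zero_ne_one (tendsto_nhds_unique h2 h4)

lemma phr_small (G g : ℝ → ℝ)
    (hGg : ∀ x : ℝ, G x = ∫ t in Set.Iic x, g t)
    (hi : ∀ x, IntegrableOn g (Set.Iic x)) (ε : ℝ) (hε : 0 < ε) : ∃ x, G x < ε := by
  have h2 : Filter.Tendsto (fun n : ℕ => ∫ t in Set.Iic (-(n : ℝ)), g t) Filter.atTop
      (nhds (∫ t in (⋂ n : ℕ, Set.Iic (-(n : ℝ))), g t)) := by
    apply tendsto_setIntegral_of_antitone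
    · intro i; exact measurableSet_Iic
    · intro i j hij
      exact Set.Iic_subset_Iic.2 (by simpa using hij)
    · exact ⟨0, hi _⟩
  have h3 : (⋂ n : ℕ, Set.Iic (-(n : ℝ))) = ∅ := by
    ext y
    simp only [Set.mem_iInter, Set.mem_Iic, Set.mem_empty_iff_false, iff_false, not_forall, not_le]
    obtain ⟨n, hn⟩ := exists_nat_gt (-y)
    exact ⟨n, by linarith⟩
  rw [h3, setIntegral_empty] at h2
  obtain ⟨n, hn⟩ := (h2.eventually (gt_mem_nhds hε)).exists
  exact ⟨_, by rw [hGg]; exact hn⟩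

lemma phr_deriv (G g : ℝ → ℝ)
    (hGg : ∀ x : ℝ, G x = ∫ t in Set.Iic x, g t)
    (hi : ∀ x, IntegrableOn g (Set.Iic x)) :
    (∀ a x, G x = G a + ∫ t in a..x, g t) ∧ ∀ᵐ x, HasDerivAt G (g x) x := by
  have h1 : ∀ a x, G x = G a + ∫ t in a..x, g t := by
    intro a x
    rw [← intervalIntegral.integral_Iic_sub_Iic (hi a) (hi x), hGg, hGg]; ring
  refine ⟨h1, ?_⟩
  have hl : LocallyIntegrable g volume := by
    intro x
    exact ⟨Set.Iic (x + 1), Iic_mem_nhds (by linarith), hi _⟩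
  filter_upwards [_root_.LocallyIntegrable.ae_hasDerivAt_integral hl] with x hx
  have := (hx 0).const_add (G 0)
  exact this.congr_of_eventuallyEq (Filter.Eventually.of_forall fun y => h1 0 y)

lemma phr_ftc (c : ℝ) (G g : ℝ → ℝ) (hG_mono : Monotone G)
    (hGg : ∀ x : ℝ, G x = ∫ t in Set.Iic x, g t)
    (hi : ∀ x, IntegrableOn g (Set.Iic x)) (a b : ℝ) (hab : a ≤ b) (hb : G b < 1) :
    IntervalIntegrable (fun t => c * (1 - G t) ^ (c - 1) * g t) volume a b ∧
    ∫ t in a..b, c * (1 - G t) ^ (c - 1) * g t = (1 - G a) ^ c - (1 - G b) ^ c := by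
  obtain ⟨h1, h2⟩ := phr_deriv G g hGg hi
  have hii : IntervalIntegrable g volume a b := by
    rw [intervalIntegrable_iff_integrableOn_Ioc_of_le hab]
    exact (hi b).mono_set Set.Ioc_subset_Iic_self
  have hac : AbsolutelyContinuousOnInterval G a b := by
    have hc := LipschitzOnWith.absolutelyContinuousOnInterval (a := a) (b := b)
      (LipschitzWith.const (G a)).lipschitzOnWith
    have := hc.add
      (hii.absolutelyContinuousOnInterval_intervalIntegral (c := a) (by simp))
    have he : G = (fun _ => G a) + fun x => ∫ t in a..x, g t := funext fun x => h1 a x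
    rw [he]
    exact this
  have hlip : ∃ K, LipschitzOnWith K (fun v : ℝ => -(1 - v) ^ c) (Set.Icc (G a) (G b)) := by
    have : ContDiffOn ℝ 1 (fun v : ℝ => -(1 - v) ^ c) (Set.Icc (G a) (G b)) := by
      apply ContDiffOn.neg
      apply ContDiffOn.rpow_const_of_ne
      · fun_prop
      · intro x hx
        have := hx.2
        linarith
    exact this.exists_lipschitzOnWith (by decide) (convex_Icc _ _) isCompact_Icc
  obtain ⟨K, hK⟩ := hlip
  have hF := ac_comp_lip hK (a := a) (b := b) (G := G) (by
    intro x hx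
    rw [Set.uIcc_of_le hab] at hx
    exact ⟨hG_mono hx.1, hG_mono hx.2⟩) hac
  have hd : ∀ᵐ x, x ∈ Set.uIoc a b → deriv (fun x => -(1 - G x) ^ c) x
      = c * (1 - G x) ^ (c - 1) * g x := by
    filter_upwards [h2] with x hx hxm
    rw [Set.uIoc_of_le hab] at hxm
    have hlt : G x < 1 := (hG_mono hxm.2).trans_lt hb
    have := ((hx.const_sub 1).rpow_const (p := c) (Or.inl (by linarith))).neg
    have h3 := this.deriv
    refine Eq.trans h3 ?_
    ring
  constructor
  · have := hF.intervalIntegrable_deriv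
    refine this.congr_ae ?_
    rw [Filter.EventuallyEq, ae_restrict_iff' measurableSet_uIoc]
    exact hd
  · rw [← intervalIntegral.integral_congr_ae hd, hF.integral_deriv_eq_sub]
    ring

lemma phr_null (θ : ℝ) (hθ : 0 < θ)
    (G g : ℝ → ℝ) (hG_cont : Continuous G) (hG_mono : Monotone G)
    (hGg : ∀ x : ℝ, G x = ∫ t in Set.Iic x, g t)
    (hi : ∀ x, IntegrableOn g (Set.Iic x))
    (μ : Measure ℝ) [IsProbabilityMeasure μ]
    (hsurv : ∀ x : ℝ, μ (Set.Ioi x) = ENNReal.ofReal ((1 - G x) ^ (1 / θ))) :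
    μ {x | G x < 1}ᶜ = 0 := by
  by_cases hne : ∃ y, 1 ≤ G y
  swap
  · push Not at hne
    simp [hne]
  obtain ⟨y, hy⟩ := hne
  have key : ∀ ε : ℝ, 0 < ε → ε < 1 → μ {x | G x < 1}ᶜ ≤ ENNReal.ofReal (ε ^ (1 / θ)) := by
    intro ε h0 h1
    obtain ⟨z, hz⟩ := phr_small G g hGg hi (1 - ε) (by linarith)
    obtain ⟨a, ha⟩ := mem_range_of_exists_le_of_exists_ge hG_cont (c := 1 - ε) ⟨z, hz.le⟩
      ⟨y, by linarith⟩
    have : ε = 1 - G a := by rw [ha]; ring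
    rw [this, ← hsurv]
    apply measure_mono
    intro x hx
    simp only [Set.mem_compl_iff, Set.mem_ofPred_eq, not_lt] at hx
    by_contra hxa
    simp only [Set.mem_Ioi, not_lt] at hxa
    have := hG_mono hxa
    linarith
  have hlim : Filter.Tendsto (fun ε : ℝ => ENNReal.ofReal (ε ^ (1 / θ))) (nhdsWithin 0 (Set.Ioi 0))
      (nhds 0) := by
    have : Continuous (fun ε : ℝ => ENNReal.ofReal (ε ^ (1 / θ))) :=
      ENNReal.continuous_ofReal.comp (Real.continuous_rpow_const (by positivity))
    have h := this.tendsto 0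
    rw [Real.zero_rpow (by positivity), ENNReal.ofReal_zero] at h
    exact h.mono_left nhdsWithin_le_nhds
  refine le_antisymm (ge_of_tendsto hlim ?_) (zero_le)
  filter_upwards [Ioo_mem_nhdsGT (zero_lt_one' ℝ)] with ε hε
  exact key ε hε.1 hε.2

lemma phr_density (θ : ℝ) (hθ : 0 < θ)
    (G g : ℝ → ℝ) (hG_cont : Continuous G) (hG_mono : Monotone G)
    (hGg : ∀ x : ℝ, G x = ∫ t in Set.Iic x, g t)
    (hi : ∀ x, IntegrableOn g (Set.Iic x))
    (μ : Measure ℝ) [IsProbabilityMeasure μ]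
    (hsurv : ∀ x : ℝ, μ (Set.Ioi x) = ENNReal.ofReal ((1 - G x) ^ (1 / θ))) :
    μ = (volume.restrict {x | G x < 1}).withDensity
      (fun t => ((1 / θ * (1 - G t) ^ (1 / θ - 1) * g t).toNNReal : ENNReal)) := by
  set ρ : ℝ → ENNReal :=
    (fun t => ((1 / θ * (1 - G t) ^ (1 / θ - 1) * g t).toNNReal : ENNReal)) with hρ
  have hA : MeasurableSet {x | G x < 1} := (isOpen_lt hG_cont continuous_const).measurableSet
  have hnull := phr_null θ hθ G g hG_cont hG_mono hGg hi μ hsurv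
  have hg0 : ∀ᵐ x, 0 ≤ g x := by
    filter_upwards [(phr_deriv G g hGg hi).2] with x hx
    rw [← hx.deriv]; exact hG_mono.deriv_nonneg
  have hb : ∀ b, G b < 1 → μ.restrict (Set.Iic b) = (volume.withDensity ρ).restrict (Set.Iic b) := by
    intro b hb
    apply Measure.ext_of_Ioc
    intro a d had
    rw [Measure.restrict_apply measurableSet_Ioc, Measure.restrict_apply measurableSet_Ioc]
    have hset : Set.Ioc a d ∩ Set.Iic b = Set.Ioc a (min d b) := by
      ext x; simp only [Set.mem_inter_iff, Set.mem_Ioc, Set.mem_Iic, le_min_iff]; tauto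
    rw [hset]
    rcases le_or_gt (min d b) a with hle | hlt
    · simp [Set.Ioc_eq_empty (not_lt.2 hle)]
    set e := min d b
    have he : G e < 1 := (hG_mono (min_le_right _ _)).trans_lt hb
    have ha : G a ≤ G e := hG_mono hlt.le
    obtain ⟨hint, hval⟩ := phr_ftc (1 / θ) G g hG_mono hGg hi a e hlt.le he
    have hnn : 0 ≤ᵐ[volume.restrict (Set.Ioc a e)]
        (fun t => 1 / θ * (1 - G t) ^ (1 / θ - 1) * g t) := by
      rw [Filter.EventuallyLE, ae_restrict_iff' measurableSet_Ioc]
      filter_upwards [hg0] with x hx hxm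
      have : G x ≤ G e := hG_mono hxm.2
      have : 0 ≤ 1 - G x := by linarith
      simp only [Pi.zero_apply]
      positivity
    rw [withDensity_apply _ measurableSet_Ioc]
    have hr : ∫⁻ t in Set.Ioc a e, ρ t = ENNReal.ofReal ((1 - G a) ^ (1/θ) - (1 - G e) ^ (1/θ)) := by
      rw [← hval, intervalIntegral.integral_of_le hlt.le,
        ofReal_integral_eq_lintegral_ofReal
          ((intervalIntegrable_iff_integrableOn_Ioc_of_le hlt.le).1 hint) hnn]
      rfl
    rw [hr, ← Set.Ioi_sdiff_Ioi, measure_sdiff (Set.Ioi_subset_Ioi hlt.le)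
      measurableSet_Ioi.nullMeasurableSet (measure_ne_top _ _), hsurv, hsurv,
      ENNReal.ofReal_sub _ (by apply Real.rpow_nonneg; linarith)]
  have hU : {x | G x < 1} = ⋃ q : {q : ℚ // G q < 1}, Set.Iic ((q : ℚ) : ℝ) := by
    ext x
    simp only [Set.mem_ofPred_eq, Set.mem_iUnion, Set.mem_Iic]
    constructor
    · intro hx
      have h1 : ∀ᶠ y in nhdsWithin x (Set.Ioi x), G y < 1 :=
        ((hG_cont.tendsto x).eventually (gt_mem_nhds hx)).filter_mono nhdsWithin_le_nhds
      obtain ⟨y, hy, hxy⟩ := (h1.and self_mem_nhdsWithin).exists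
      obtain ⟨q, hq1, hq2⟩ := exists_rat_btwn (show x < y from hxy)
      exact ⟨⟨q, (hG_mono hq2.le).trans_lt hy⟩, hq1.le⟩
    · rintro ⟨q, hq⟩
      exact (hG_mono hq).trans_lt q.2
  have h1 : μ.restrict {x | G x < 1} = (volume.withDensity ρ).restrict {x | G x < 1} := by
    rw [hU, Measure.restrict_iUnion_congr]
    intro q
    exact hb _ q.2
  rw [← restrict_withDensity hA, ← h1]
  symm
  apply Measure.restrict_eq_self_of_ae_mem
  exact hnull

/-- Robbins U-V identity for the proportional hazard rate family. -/
theorem robbins_phr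
    (θ : ℝ) (hθ : 0 < θ)
    (G g : ℝ → ℝ) (hG_cont : Continuous G) (hG_mono : Monotone G)
    (hg_meas : Measurable g)
    (hGg : ∀ x : ℝ, G x = ∫ t in Set.Iic x, g t)
    (h : ℝ → ℝ) (hh : ∀ x : ℝ, h x = g x / (1 - G x))
    (μ : Measure ℝ) [IsProbabilityMeasure μ]
    (hsurv : ∀ x : ℝ, μ (Set.Ioi x) = ENNReal.ofReal ((1 - G x) ^ (1 / θ)))
    (u : ℝ → ℝ) (hu_meas : Measurable u) (hu_int : Integrable u μ)
    (hfin : ∀ x : ℝ, IntegrableOn (fun t => u t * h t) (Set.Iic x) volume)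
    (ν : ℝ → ℝ) (hν : ∀ x : ℝ, ν x = ∫ t in Set.Iic x, u t * h t) :
    ∫ x, ν x ∂μ = θ * ∫ x, u x ∂μ := by
  have hi := phr_integrable θ G g hGg μ hsurv
  have hnull := phr_null θ hθ G g hG_cont hG_mono hGg hi μ hsurv
  have hdens := phr_density θ hθ G g hG_cont hG_mono hGg hi μ hsurv
  have hA : MeasurableSet {x | G x < 1} := (isOpen_lt hG_cont continuous_const).measurableSet
  have hGm : Measurable G := hG_cont.measurable
  have hhm : Measurable h := by
    have : h = fun x => g x / (1 - G x) := funext hh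
    rw [this]; fun_prop
  have hρm : Measurable (fun t => (1 / θ * (1 - G t) ^ (1 / θ - 1) * g t).toNNReal) := by
    fun_prop
  have hg0 : ∀ᵐ x, 0 ≤ g x := by
    filter_upwards [(phr_deriv G g hGg hi).2] with x hx
    rw [← hx.deriv]; exact hG_mono.deriv_nonneg
  have hac : μ ≪ volume := by
    rw [hdens]
    exact (withDensity_absolutelyContinuous _ _).trans Measure.restrict_le_self.absolutelyContinuous
  have hIci : ∀ t, G t < 1 → μ.real (Set.Ici t) = (1 - G t) ^ (1 / θ) := by
    intro t ht
    have h0 : μ {t} = 0 := hac (by simp)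
    have : μ (Set.Ici t) = μ (Set.Ioi t) := by
      rw [← Set.Ioi_insert]
      refine le_antisymm ((measure_union_le {t} (Set.Ioi t)).trans ?_) (measure_mono (Set.subset_insert _ _))
      rw [h0, zero_add]
    rw [Measure.real, this, hsurv, ENNReal.toReal_ofReal]
    apply Real.rpow_nonneg; linarith
  have hIci0 : ∀ t, ¬ G t < 1 → μ.real (Set.Ici t) = 0 := by
    intro t ht
    have : μ (Set.Ici t) = 0 := by
      refine measure_mono_null ?_ hnull
      intro x hx hx1
      exact ht ((hG_mono hx).trans_lt hx1)
    simp [Measure.real, this]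
  have hkey : ∀ᵐ t, μ.real (Set.Ici t) * (u t * h t) = {x | G x < 1}.indicator
      (fun t => θ * ((1 / θ * (1 - G t) ^ (1 / θ - 1) * g t).toNNReal • u t)) t := by
    filter_upwards [hg0] with t ht
    by_cases hG1 : G t < 1
    · rw [hIci t hG1, Set.indicator_of_mem (by exact hG1), hh, NNReal.smul_def, smul_eq_mul]
      have hp : 0 < 1 - G t := by linarith
      rw [Real.coe_toNNReal _ (by positivity), Real.rpow_sub_one hp.ne']
      field_simp
    · rw [hIci0 t hG1, Set.indicator_of_notMem (by exact hG1), zero_mul]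
  let f : ℝ → ℝ → ℝ := fun x t => (Set.Iic x).indicator (fun t => u t * h t) t
  have hf' : ∀ t, (fun x => f x t) = (Set.Ici t).indicator (fun _ => u t * h t) := by
    intro t; ext x
    simp only [f, Set.indicator, Set.mem_Iic, Set.mem_Ici]
  have hinner : ∀ t, ∫ x, f x t ∂μ = μ.real (Set.Ici t) * (u t * h t) := by
    intro t
    rw [hf', integral_indicator_const _ measurableSet_Ici, smul_eq_mul]
  have hI : Integrable ({x | G x < 1}.indicator
      (fun t => θ * ((1 / θ * (1 - G t) ^ (1 / θ - 1) * g t).toNNReal • u t))) := by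
    rw [integrable_indicator_iff hA]
    refine Integrable.const_mul ?_ _
    rw [hdens] at hu_int
    exact (integrable_withDensity_iff_integrable_smul hρm).1 hu_int
  have hfm : Measurable (Function.uncurry f) := by
    have : Function.uncurry f = {p : ℝ × ℝ | p.2 ≤ p.1}.indicator (fun p => u p.2 * h p.2) := by
      ext p
      simp [Function.uncurry, f, Set.indicator]
    rw [this]
    exact Measurable.indicator (by fun_prop) (measurableSet_le measurable_snd measurable_fst)
  have hfint : Integrable (Function.uncurry f) (μ.prod volume) := by
    rw [integrable_prod_iff' hfm.aestronglyMeasurable]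
    constructor
    · refine Filter.Eventually.of_forall fun t => ?_
      change Integrable (fun x => f x t) μ
      rw [hf']
      exact (integrable_const _).indicator measurableSet_Ici
    · refine hI.norm.congr ?_
      filter_upwards [hkey] with t ht
      rw [← ht]
      have : (fun x => ‖Function.uncurry f (x, t)‖)
          = (Set.Ici t).indicator (fun _ => ‖u t * h t‖) := by
        ext x
        change ‖(fun x => f x t) x‖ = _
        rw [hf', Set.indicator, Set.indicator]
        split_ifs <;> simp
      rw [this, integral_indicator_const _ measurableSet_Ici, smul_eq_mul, norm_mul,
        Real.norm_of_nonneg measureReal_nonneg]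
  calc ∫ x, ν x ∂μ = ∫ x, (∫ t, f x t) ∂μ := by
        refine integral_congr_ae (Filter.Eventually.of_forall fun x => ?_)
        simp only [f]
        rw [hν, integral_indicator measurableSet_Iic]
    _ = ∫ t, ∫ x, f x t ∂μ := integral_integral_swap hfint
    _ = ∫ t, {x | G x < 1}.indicator
      (fun t => θ * ((1 / θ * (1 - G t) ^ (1 / θ - 1) * g t).toNNReal • u t)) t := by
        refine integral_congr_ae ?_
        filter_upwards [hkey] with t ht
        rw [hinner, ht]
    _ = θ * ∫ x, u x ∂μ := by
        rw [integral_indicator hA, integral_const_mul]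
        conv_rhs => rw [hdens]
        rw [integral_withDensity_eq_integral_smul hρm]
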